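/- Let a ∈ ℝ and r ∈ ℝ with 0 < r < 1, and let σ ∈ ℂ with σ ≠ 0, σ ≠ r, σ ≠ r⁻¹, such that neither 1 − rσ nor 1 − rσ⁻¹ lies on the nonpositive real axis. Define E₁(σ) = −a²/(2(1−rσ)²) + a²r²/(2(σ−r)²) + a²r/((1−r²)(σ−r)) − a²r²/((1−r²)(1−rσ)) − (2a²r²/(1−r²)²)·(log(1−rσ^{−1}) − log(1−rσ)), D₁ = −2a²r²/(1−r²)², and C₁(σ) = −a²r·[1/(1−rσ)³ + r/(σ−r)³ + (1−r²)/((1−rσ)²(σ−r)²)]. Then E₁′(σ) + D₁/σ = C₁(σ); that is, E₁(σ) + D₁·log σ is an antiderivative of C₁ (Eqs. (A.3), (A.4a), (A.5a) of the paper with j = 1). -/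

import Mathlib

open Complex

/-- Eqs. (A.3), (A.4a), (A.5a) of the paper with `j = 1`:
`E₁(σ) + D₁·log σ` is an antiderivative of `C₁(σ)`, i.e. `E₁′(σ) + D₁/σ = C₁(σ)`,
stated as `HasDerivAt E₁ (C₁(σ) − D₁/σ) σ`. -/
theorem antiderivative_E1_D1_C1
    (a r : ℝ) (hr0 : 0 < r) (hr1 : r < 1)
    (σ : ℂ) (hσ : σ ≠ 0) (hσr : σ ≠ (r : ℂ)) (hσri : σ ≠ ((r : ℂ))⁻¹)
    (h1 : 1 - (r : ℂ) * σ ∈ Complex.slitPlane)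
    (h2 : 1 - (r : ℂ) * σ⁻¹ ∈ Complex.slitPlane) :
    HasDerivAt (fun σ : ℂ =>
        -(a : ℂ) ^ 2 / (2 * (1 - (r : ℂ) * σ) ^ 2)
          + (a : ℂ) ^ 2 * (r : ℂ) ^ 2 / (2 * (σ - (r : ℂ)) ^ 2)
          + (a : ℂ) ^ 2 * (r : ℂ) / ((1 - (r : ℂ) ^ 2) * (σ - (r : ℂ)))
          - (a : ℂ) ^ 2 * (r : ℂ) ^ 2 / ((1 - (r : ℂ) ^ 2) * (1 - (r : ℂ) * σ))
          - (2 * (a : ℂ) ^ 2 * (r : ℂ) ^ 2 / (1 - (r : ℂ) ^ 2) ^ 2)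
              * (Complex.log (1 - (r : ℂ) * σ⁻¹) - Complex.log (1 - (r : ℂ) * σ)))
      ((-(a : ℂ) ^ 2 * (r : ℂ) * (1 / (1 - (r : ℂ) * σ) ^ 3
          + (r : ℂ) / (σ - (r : ℂ)) ^ 3
          + (1 - (r : ℂ) ^ 2) / ((1 - (r : ℂ) * σ) ^ 2 * (σ - (r : ℂ)) ^ 2)))
        - (-2 * (a : ℂ) ^ 2 * (r : ℂ) ^ 2 / (1 - (r : ℂ) ^ 2) ^ 2) / σ) σ := by
  have hu : 1 - (r : ℂ) * σ ≠ 0 := Complex.slitPlane_ne_zero h1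
  have hv : σ - (r : ℂ) ≠ 0 := sub_ne_zero.mpr hσr
  have hs : 1 - (r : ℂ) ^ 2 ≠ 0 := by
    have h : (1 - r ^ 2 : ℝ) ≠ 0 := by nlinarith
    exact_mod_cast h
  have hw : 1 - (r : ℂ) * σ⁻¹ = (σ - r) / σ := by field_simp
  have du : HasDerivAt (fun σ : ℂ => 1 - (r : ℂ) * σ) (-(r : ℂ)) σ := by
    simpa using ((hasDerivAt_id σ).const_mul (r : ℂ)).const_sub 1
  have dv : HasDerivAt (fun σ : ℂ => σ - (r : ℂ)) 1 σ := (hasDerivAt_id σ).sub_const _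
  have dw : HasDerivAt (fun σ : ℂ => 1 - (r : ℂ) * σ⁻¹) (-((r : ℂ) * (-(σ ^ 2)⁻¹))) σ :=
    ((hasDerivAt_inv hσ).const_mul (r : ℂ)).const_sub 1
  have t1 := (hasDerivAt_const σ (-(a : ℂ) ^ 2)).fun_div ((du.fun_pow 2).const_mul 2)
    (by simp [hu])
  have t2 := (hasDerivAt_const σ ((a : ℂ) ^ 2 * (r : ℂ) ^ 2)).fun_div ((dv.fun_pow 2).const_mul 2)
    (by simp [hv])
  have t3 := (hasDerivAt_const σ ((a : ℂ) ^ 2 * (r : ℂ))).fun_div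
    (dv.const_mul (1 - (r : ℂ) ^ 2)) (mul_ne_zero hs hv)
  have t4 := (hasDerivAt_const σ ((a : ℂ) ^ 2 * (r : ℂ) ^ 2)).fun_div
    (du.const_mul (1 - (r : ℂ) ^ 2)) (mul_ne_zero hs hu)
  have t5 := ((dw.clog h2).fun_sub (du.clog h1)).const_mul
    (2 * (a : ℂ) ^ 2 * (r : ℂ) ^ 2 / (1 - (r : ℂ) ^ 2) ^ 2)
  refine ((((t1.fun_add t2).fun_add t3).fun_sub t4).fun_sub t5).congr_deriv ?_
  rw [hw]
  clear t1 t2 t3 t4 t5 dw dv du hw h1 h2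
  have hrel : 1 - (r : ℂ) * σ = (1 - (r : ℂ) ^ 2) - r * (σ - r) := by ring
  have hσe : σ = (σ - r) + r := by ring
  generalize (1 - (r : ℂ) * σ) = u at *
  generalize (1 - (r : ℂ) ^ 2) = s at *
  generalize (r : ℂ) = r' at *
  generalize (a : ℂ) = a' at *
  obtain ⟨v, hve⟩ : ∃ v, v = σ - r' := ⟨_, rfl⟩
  rw [← hve] at hv hrel ⊢
  have hse : s = u + r' * v := by rw [hrel]; ring
  clear hrel
  have e1 : r' / (σ * v) = 1 / v - 1 / σ := by field_simp; rw [hve]; ring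
  have e2 : 1 / v + r' / u = s / (u * v) := by field_simp; rw [hse]; ring
  simp only [Nat.cast_ofNat, zero_mul, zero_sub, mul_one]
  have e3 : -(r' * -(σ ^ 2)⁻¹) / (v / σ) = 1 / v - 1 / σ := by rw [← e1]; field_simp
  rw [e3]
  have e4 : 1 / v - 1 / σ - -r' / u = s / (u * v) - 1 / σ := by rw [← e2]; ring
  rw [e4]
  clear e1 e2 e3 e4 hve hσe
  field_simp
  rw [hse]
  ring
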